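/- Let X be a compact metric space and f : X → X a continuous map. If x is a shadowable point for f and x is an upper semicontinuity point or a lower semicontinuity point of the ω-limit set map ω_f, then the chain component C_f(x) containing ω_f(x) is terminal, i.e., chain stable. -/

import Mathlib

open Filter Topology

variable {X : Type*} [MetricSpace X]

/-- The ω-limit set of `x` under `f`: points `y` with `f^[φ j] x → y` for some
strictly increasing sequence `φ`. -/
def omegaLimitPt (f : X → X) (x : X) : Set X :=
  {y | ∃ φ : ℕ → ℕ, StrictMono φ ∧ Tendsto (fun j => f^[φ j] x) atTop (𝓝 y)}

/-- The set `Ω_f(x)`: points `y` such that there are `x_j → x` and a strictly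
increasing sequence `φ` with `f^[φ j] (x_j) → y`. -/
def bigOmega (f : X → X) (x : X) : Set X :=
  {y | ∃ (xs : ℕ → X) (φ : ℕ → ℕ), StrictMono φ ∧
    Tendsto xs atTop (𝓝 x) ∧ Tendsto (fun j => f^[φ j] (xs j)) atTop (𝓝 y)}

/-- `x` is a shadowable point for `f`. -/
def ShadowablePoint (f : X → X) (x : X) : Prop :=
  ∀ ε > 0, ∃ δ > 0, ∀ xs : ℕ → X, (∀ i, dist (f (xs i)) (xs (i + 1)) ≤ δ) →
    xs 0 = x → ∃ y, ∀ i, dist (xs i) (f^[i] y) ≤ ε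

/-- `x` is an upper semicontinuity point of the ω-limit set map. -/
def USCPoint (f : X → X) (x : X) : Prop :=
  ∀ U : Set X, IsOpen U → omegaLimitPt f x ⊆ U →
    ∃ δ > 0, ∀ y, dist x y ≤ δ → omegaLimitPt f y ⊆ U

/-- `x` is a lower semicontinuity point of the ω-limit set map. -/
def LSCPoint (f : X → X) (x : X) : Prop :=
  ∀ U : Set X, IsOpen U → (omegaLimitPt f x ∩ U).Nonempty →
    ∃ δ > 0, ∀ y, dist x y ≤ δ → (omegaLimitPt f y ∩ U).Nonempty

/-- `(c i)_{i=0}^k` is a `δ`-chain of `f` (with `k ≥ 1`). -/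
def IsDeltaChain (f : X → X) (δ : ℝ) (c : ℕ → X) (k : ℕ) : Prop :=
  1 ≤ k ∧ ∀ i < k, dist (f (c i)) (c (i + 1)) ≤ δ

/-- `y → z`: for every `δ > 0` there is a `δ`-chain of `f` from `y` to `z`. -/
def ChainReach (f : X → X) (y z : X) : Prop :=
  ∀ δ > 0, ∃ (c : ℕ → X) (k : ℕ), IsDeltaChain f δ c k ∧ c 0 = y ∧ c k = z

/-- A set `S` is chain stable: `y ∈ S` and `y → z` imply `z ∈ S`. -/
def ChainStable (f : X → X) (S : Set X) : Prop :=
  ∀ y ∈ S, ∀ z, ChainReach f y z → z ∈ S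

/-- The set `ω_f*(x)`: points reachable from `x` by arbitrarily fine and
arbitrarily long `δ`-chains. -/
def omegaStar (f : X → X) (x : X) : Set X :=
  {y | ∀ δ > 0, ∀ l : ℕ, 1 ≤ l → ∃ (c : ℕ → X) (k : ℕ),
    l ≤ k ∧ IsDeltaChain f δ c k ∧ c 0 = x ∧ c k = y}

/-- The chain component of a point `p`. -/
def chainComponent (f : X → X) (p : X) : Set X :=
  {q | ChainReach f p q ∧ ChainReach f q p}

/-- `f` is chain continuous at `x`. -/
def ChainContinuousAt (f : X → X) (x : X) : Prop :=
  ∀ ε > 0, ∃ δ > 0, ∀ xs : ℕ → X, (∀ i, dist (f (xs i)) (xs (i + 1)) ≤ δ) →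
    xs 0 = x → ∀ i, dist (xs i) (f^[i] x) ≤ ε

/-- The chain recurrent set `CR(f)`. -/
def chainRecurrent (f : X → X) : Set X := {x | ChainReach f x x}

/-- `x` is a regularly recurrent point for `f`. -/
def RegularlyRecurrent (f : X → X) (x : X) : Prop :=
  ∀ ε > 0, ∃ k : ℕ, 1 ≤ k ∧ ∀ j : ℕ, dist x (f^[j * k] x) ≤ ε

/-- `M` is a minimal set for `f`. -/
def IsMinimalSet (f : X → X) (M : Set X) : Prop :=
  M.Nonempty ∧ IsClosed M ∧ f '' M ⊆ M ∧ ∀ y ∈ M, omegaLimitPt f y = M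

/-- There is a `δ`-chain of `f` from `a` to `b`. -/
def DeltaReach (f : X → X) (δ : ℝ) (a b : X) : Prop :=
  ∃ (c : ℕ → X) (k : ℕ), IsDeltaChain f δ c k ∧ c 0 = a ∧ c k = b

theorem DeltaReach.trans {f : X → X} {δ : ℝ} {a b c : X} (hab : DeltaReach f δ a b)
    (hbc : DeltaReach f δ b c) : DeltaReach f δ a c := by
  obtain ⟨u, k, ⟨hk, hu⟩, hu0, huk⟩ := hab
  obtain ⟨v, l, ⟨hl, hv⟩, hv0, hvl⟩ := hbc
  refine ⟨fun i => if i < k then u i else v (i - k), k + l, ⟨by omega, fun i hi => ?_⟩, ?_, ?_⟩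
  · rcases lt_trichotomy (i + 1) k with h | h | h
    · simpa [h, show i < k by omega] using hu i (by omega)
    · have := hu i (by omega)
      rw [h, huk] at this
      simpa [show i < k by omega, h, hv0] using this
    · have := hv (i - k) (by omega)
      rw [show i - k + 1 = i + 1 - k by omega] at this
      simpa [show ¬ i < k by omega, show ¬ i + 1 < k by omega] using this
  · simpa [show 0 < k by omega] using hu0
  · simpa using hvl

theorem ChainReach.trans {f : X → X} {a b c : X} (hab : ChainReach f a b)
    (hbc : ChainReach f b c) : ChainReach f a c := fun δ hδ =>
  DeltaReach.trans (hab δ hδ) (hbc δ hδ)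

/-- An orbit segment whose endpoint is moved by at most `δ` is a `δ`-chain. -/
theorem deltaReach_of_dist_iterate_le {f : X → X} {δ : ℝ} (hδ : 0 ≤ δ) {a b : X} {n : ℕ}
    (hn : 1 ≤ n) (h : dist (f^[n] a) b ≤ δ) : DeltaReach f δ a b := by
  refine ⟨fun i => if i < n then f^[i] a else b, n, ⟨hn, fun i hi => ?_⟩, ?_, ?_⟩
  · by_cases h1 : i + 1 < n
    · simpa [hi, h1, Function.iterate_succ_apply'] using hδ
    · obtain rfl : n = i + 1 := by omega
      simpa [Function.iterate_succ_apply'] using h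
  · simp [show 0 < n by omega]
  · simp

/-- A `δ`-chain followed by the orbit of its endpoint is a `δ`-pseudo orbit. -/
theorem DeltaReach.exists_pseudoOrbit {f : X → X} {δ : ℝ} (hδ : 0 ≤ δ) {a b : X}
    (h : DeltaReach f δ a b) : ∃ (xs : ℕ → X) (k : ℕ),
      (∀ i, dist (f (xs i)) (xs (i + 1)) ≤ δ) ∧ xs 0 = a ∧ ∀ i, xs (k + i) = f^[i] b := by
  obtain ⟨u, k, ⟨hk, hu⟩, hu0, huk⟩ := h
  refine ⟨fun i => if i < k then u i else f^[i - k] b, k, fun i => ?_, ?_, fun i => by simp⟩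
  · rcases lt_trichotomy (i + 1) k with h | h | h
    · simpa [h, show i < k by omega] using hu i (by omega)
    · have := hu i (by omega)
      rw [h, huk] at this
      simpa [show i < k by omega, h] using this
    · simpa [show ¬ i < k by omega, show ¬ i + 1 < k by omega,
        show i + 1 - k = i - k + 1 by omega, Function.iterate_succ_apply'] using hδ
  · simpa [show 0 < k by omega] using hu0

theorem exists_dist_iterate_lt_of_mem_omegaLimitPt {f : X → X} {x y : X}
    (h : y ∈ omegaLimitPt f x) {ε : ℝ} (hε : 0 < ε) (N : ℕ) :
    ∃ n ≥ N, dist (f^[n] x) y < ε := by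
  obtain ⟨φ, hφ, hlim⟩ := h
  obtain ⟨j, hj, hjN⟩ :=
    ((hlim.eventually (Metric.ball_mem_nhds y hε)).and (eventually_ge_atTop N)).exists
  exact ⟨φ j, hjN.trans (hφ.id_le j), hj⟩

theorem omegaLimitPt_nonempty [CompactSpace X] (f : X → X) (x : X) :
    (omegaLimitPt f x).Nonempty := by
  obtain ⟨y, φ, hφ, h⟩ := CompactSpace.tendsto_subseq (fun n => f^[n] x)
  exact ⟨y, φ, hφ, h⟩

/-- At a semicontinuity point, the ω-limit sets of nearby points come close to that of the
point. -/
theorem exists_near_omegaLimitPt_of_semicontinuity [CompactSpace X] {f : X → X} {x : X}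
    (h : USCPoint f x ∨ LSCPoint f x) {η : ℝ} (hη : 0 < η) :
    ∃ ε > 0, ∀ y, dist x y ≤ ε →
      ∃ w ∈ omegaLimitPt f y, ∃ q ∈ omegaLimitPt f x, dist w q < η := by
  rcases h with h | h
  · obtain ⟨ε, hε, H⟩ := h (Metric.thickening η (omegaLimitPt f x)) Metric.isOpen_thickening
      (Metric.self_subset_thickening hη _)
    refine ⟨ε, hε, fun y hy => ?_⟩
    obtain ⟨w, hw⟩ := omegaLimitPt_nonempty f y
    exact ⟨w, hw, Metric.mem_thickening_iff.1 (H y hy hw)⟩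
  · obtain ⟨q, hq⟩ := omegaLimitPt_nonempty f x
    obtain ⟨ε, hε, H⟩ := h (Metric.ball q η) Metric.isOpen_ball
      ⟨q, hq, Metric.mem_ball_self hη⟩
    refine ⟨ε, hε, fun y hy => ?_⟩
    obtain ⟨w, hw, hwq⟩ := H y hy
    exact ⟨w, hw, q, hq, hwq⟩

/-- If `x` is a shadowable semicontinuity point and `p` lies in its ω-limit set, then `p` is
chain-reachable from every point chain-reachable from `p`. -/
theorem chainReach_of_shadowablePoint [CompactSpace X] {f : X → X} {x : X}
    (hsh : ShadowablePoint f x) (h : USCPoint f x ∨ LSCPoint f x) {p z : X}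
    (hp : p ∈ omegaLimitPt f x) (hpz : ChainReach f p z) : ChainReach f z p := by
  intro δ hδ
  have hη : 0 < δ / 4 := by positivity
  obtain ⟨ε, hε, hnear⟩ := exists_near_omegaLimitPt_of_semicontinuity h hη
  obtain ⟨γ, hγ, hshad⟩ := hsh (min ε (δ / 4)) (lt_min hε hη)
  obtain ⟨n, hn, hxp⟩ := exists_dist_iterate_lt_of_mem_omegaLimitPt hp hγ 1
  obtain ⟨xs, k, hxs, hx0, hxk⟩ :=
    ((deltaReach_of_dist_iterate_le hγ.le hn hxp.le).trans (hpz γ hγ)).exists_pseudoOrbit hγ.le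
  obtain ⟨y, hy⟩ := hshad xs hxs hx0
  have hxy : dist x y ≤ ε := by simpa [hx0] using (hy 0).trans (min_le_left _ _)
  obtain ⟨w, hw, q, hq, hwq⟩ := hnear y hxy
  obtain ⟨j, hj, hjw⟩ := exists_dist_iterate_lt_of_mem_omegaLimitPt hw hη (k + 1)
  obtain ⟨i, rfl⟩ := Nat.exists_eq_add_of_le (show k ≤ j by omega)
  obtain ⟨m, -, hmq⟩ := exists_dist_iterate_lt_of_mem_omegaLimitPt hq hη 0
  obtain ⟨m', hm', hmp⟩ := exists_dist_iterate_lt_of_mem_omegaLimitPt hp hδ (m + 1)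
  have hzy : dist (f^[i] z) (f^[k + i] y) ≤ δ / 4 :=
    hxk i ▸ (hy (k + i)).trans (min_le_right _ _)
  have hzx : dist (f^[i] z) (f^[m] x) ≤ δ := by
    have h1 := dist_triangle4 (f^[i] z) (f^[k + i] y) w q
    have h2 := dist_triangle_right (f^[i] z) (f^[m] x) q
    linarith
  refine (deltaReach_of_dist_iterate_le hδ.le (show 1 ≤ i by omega) hzx).trans
    (deltaReach_of_dist_iterate_le hδ.le (n := m' - m) (by omega) ?_)
  rw [← Function.iterate_add_apply, Nat.sub_add_cancel (by omega)]
  exact hmp.le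

theorem stmt8 [CompactSpace X] (f : X → X) (hf : Continuous f) (x : X)
    (hsh : ShadowablePoint f x) (h : USCPoint f x ∨ LSCPoint f x) :
    ∀ p ∈ omegaLimitPt f x, ChainStable f (chainComponent f p) := by
  intro p hp y hy z hyz
  have hpz := hy.1.trans hyz
  exact ⟨hpz, chainReach_of_shadowablePoint hsh h hp hpz⟩
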